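/- arXiv:2010.08902 — 2 statements merged into one kernel-verified Lean document; each statement's English description precedes it below -/
import Mathlib

section
/- For a prime p ≥ 5, the element δ(a,b) := ⟨a,b⟩ + ⟨-a,b⟩ + ⟨a,-b⟩ + ⟨-a,-b⟩ in B_2(C_N) ⊗ Q (defined for gcd(a,b,N)=1, using modified generators ⟨a,b⟩ = [a,b] if a,b ≠ 0 and ⟨a,0⟩ = (1/2)[a,0]) is invariant under the action of SL_2(Z/NZ) on the pair (a,b); in particular δ(a,b) = δ(-b,a) and δ(a,b) = δ(a, b-a). -/
open FreeAbelianGroup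

/-- A multiset of characters generates the character group. -/
def Adm {A : Type} [AddCommGroup A] (s : Multiset A) : Prop :=
  AddSubgroup.closure {x | x ∈ s} = ⊤

/-- Admissible symbols: multisets of `n` characters generating `A`. -/
def Symb (A : Type) [AddCommGroup A] (n : ℕ) : Type :=
  {s : Multiset A // Multiset.card s = n ∧ Adm s}

/-- The blow-up relations (B₂). -/
def blowupRels (A : Type) [AddCommGroup A] (n : ℕ) :
    Set (FreeAbelianGroup (Symb A n)) :=
  {x | ∃ (a b : A) (t : Multiset A)
      (h : Multiset.card (a ::ₘ b ::ₘ t) = n ∧ Adm (a ::ₘ b ::ₘ t))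
      (h1 : Multiset.card (a ::ₘ (b - a) ::ₘ t) = n ∧ Adm (a ::ₘ (b - a) ::ₘ t))
      (h2 : Multiset.card ((a - b) ::ₘ b ::ₘ t) = n ∧ Adm ((a - b) ::ₘ b ::ₘ t)),
      a ≠ b ∧
      x = of (⟨a ::ₘ b ::ₘ t, h⟩ : Symb A n) - of ⟨a ::ₘ (b - a) ::ₘ t, h1⟩
            - of ⟨(a - b) ::ₘ b ::ₘ t, h2⟩} ∪
  {x | ∃ (a : A) (t : Multiset A)
      (h : Multiset.card (a ::ₘ a ::ₘ t) = n ∧ Adm (a ::ₘ a ::ₘ t))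
      (h0 : Multiset.card ((0 : A) ::ₘ a ::ₘ t) = n ∧ Adm ((0 : A) ::ₘ a ::ₘ t)),
      x = of (⟨a ::ₘ a ::ₘ t, h⟩ : Symb A n) - of ⟨(0 : A) ::ₘ a ::ₘ t, h0⟩}

/-- The group of equivariant birational types `𝓑ₙ(G)`, for `A = G^∨`. -/
def B (A : Type) [AddCommGroup A] (n : ℕ) : Type :=
  FreeAbelianGroup (Symb A n) ⧸ AddSubgroup.closure (blowupRels A n)

instance (A : Type) [AddCommGroup A] (n : ℕ) : AddCommGroup (B A n) := by
  unfold B; infer_instance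

/-- The class of a symbol in `𝓑ₙ(G)`. -/
def symb {A : Type} [AddCommGroup A] {n : ℕ} (s : Multiset A)
    (h : Multiset.card s = n ∧ Adm s) : B A n :=
  QuotientAddGroup.mk (of (⟨s, h⟩ : Symb A n))

lemma adm_of_unit {N : ℕ} [NeZero N] {s : Multiset (ZMod N)} {u : ZMod N}
    (hu : u ∈ s) (h : IsUnit u) : Adm s := by
  rw [Adm, AddSubgroup.eq_top_iff']
  intro x
  have hu' : u ∈ AddSubgroup.closure {y | y ∈ s} := AddSubgroup.subset_closure hu
  obtain ⟨v, hv⟩ := h.exists_left_inv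
  have hx : x = (x * v).val • u := by
    rw [nsmul_eq_mul, ZMod.natCast_val, ZMod.cast_id, mul_assoc, hv, mul_one]
  rw [hx]
  exact AddSubgroup.nsmul_mem _ hu' _

/-- The blow-up relations, in the free ℚ-vector space on admissible symbols. -/
def blowupRelsQ (A : Type) [AddCommGroup A] (n : ℕ) :
    Set (Symb A n →₀ ℚ) :=
  {x | ∃ (a b : A) (t : Multiset A)
      (h : Multiset.card (a ::ₘ b ::ₘ t) = n ∧ Adm (a ::ₘ b ::ₘ t))
      (h1 : Multiset.card (a ::ₘ (b - a) ::ₘ t) = n ∧ Adm (a ::ₘ (b - a) ::ₘ t))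
      (h2 : Multiset.card ((a - b) ::ₘ b ::ₘ t) = n ∧ Adm ((a - b) ::ₘ b ::ₘ t)),
      a ≠ b ∧
      x = Finsupp.single (⟨a ::ₘ b ::ₘ t, h⟩ : Symb A n) 1
            - Finsupp.single ⟨a ::ₘ (b - a) ::ₘ t, h1⟩ 1
            - Finsupp.single ⟨(a - b) ::ₘ b ::ₘ t, h2⟩ 1} ∪
  {x | ∃ (a : A) (t : Multiset A)
      (h : Multiset.card (a ::ₘ a ::ₘ t) = n ∧ Adm (a ::ₘ a ::ₘ t))
      (h0 : Multiset.card ((0 : A) ::ₘ a ::ₘ t) = n ∧ Adm ((0 : A) ::ₘ a ::ₘ t)),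
      x = Finsupp.single (⟨a ::ₘ a ::ₘ t, h⟩ : Symb A n) 1
            - Finsupp.single ⟨(0 : A) ::ₘ a ::ₘ t, h0⟩ 1}

/-- `𝓑ₙ(G) ⊗ ℚ`, realized as the ℚ-vector space with the same presentation. -/
def BQ (A : Type) [AddCommGroup A] (n : ℕ) : Type :=
  (Symb A n →₀ ℚ) ⧸ Submodule.span ℚ (blowupRelsQ A n)

noncomputable instance (A : Type) [AddCommGroup A] (n : ℕ) : AddCommGroup (BQ A n) := by
  unfold BQ; infer_instance

noncomputable instance (A : Type) [AddCommGroup A] (n : ℕ) : Module ℚ (BQ A n) := by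
  unfold BQ; infer_instance

/-- The class of a symbol in `𝓑ₙ(G) ⊗ ℚ`. -/
noncomputable def symQ {A : Type} [AddCommGroup A] {n : ℕ} (s : Multiset A)
    (h : Multiset.card s = n ∧ Adm s) : BQ A n :=
  Submodule.Quotient.mk (Finsupp.single (⟨s, h⟩ : Symb A n) 1)

open Classical in
/-- The class of a symbol in `𝓑ₙ(G) ⊗ ℚ` (total version; junk value `0` on
inadmissible multisets). -/
noncomputable def symQT {A : Type} [AddCommGroup A] {n : ℕ} (s : Multiset A) :
    BQ A n :=
  if h : Multiset.card s = n ∧ Adm s then symQ s h else 0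

/-- The modified generators `⟨a,b⟩`: equal to `[a,b]` when `a,b ≠ 0` and to
`(1/2)[a,0]` when one entry vanishes. -/
noncomputable def ang {N : ℕ} (a b : ZMod N) : BQ (ZMod N) 2 :=
  (if a = 0 ∨ b = 0 then (1/2 : ℚ) else 1) • symQT {a, b}

/-- `δ(a,b) = ⟨a,b⟩ + ⟨-a,b⟩ + ⟨a,-b⟩ + ⟨-a,-b⟩` in `𝓑₂(C_N) ⊗ ℚ`. -/
noncomputable def delta {N : ℕ} (a b : ZMod N) : BQ (ZMod N) 2 :=
  ang a b + ang (-a) b + ang a (-b) + ang (-a) (-b)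

lemma aux_adm {p : ℕ} [Fact p.Prime] {a b : ZMod p} (h : a ≠ 0 ∨ b ≠ 0) :
    Multiset.card ({a, b} : Multiset (ZMod p)) = 2 ∧ Adm ({a, b} : Multiset (ZMod p)) := by
  haveI : NeZero p := ⟨(Fact.out : p.Prime).ne_zero⟩
  refine ⟨rfl, ?_⟩
  rcases h with h | h
  · exact adm_of_unit (u := a) (by simp) h.isUnit
  · exact adm_of_unit (u := b) (by simp) h.isUnit

lemma aux_blow {p : ℕ} [Fact p.Prime] {a b : ZMod p} (h : a ≠ 0 ∨ b ≠ 0) (hab : a ≠ b) :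
    (symQT {a, b} : BQ (ZMod p) 2) = symQT {a, b - a} + symQT {a - b, b} := by
  have h0 := aux_adm h
  have h1 : Multiset.card ({a, b - a} : Multiset (ZMod p)) = 2 ∧
      Adm ({a, b - a} : Multiset (ZMod p)) := aux_adm (Or.inr (sub_ne_zero.2 hab.symm))
  have h2 : Multiset.card ({a - b, b} : Multiset (ZMod p)) = 2 ∧
      Adm ({a - b, b} : Multiset (ZMod p)) := aux_adm (Or.inl (sub_ne_zero.2 hab))
  rw [symQT, symQT, symQT, dif_pos h0, dif_pos h1, dif_pos h2]
  rw [← sub_eq_zero, ← sub_sub]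
  exact (Submodule.Quotient.mk_eq_zero _).2
    (Submodule.subset_span (Or.inl ⟨a, b, 0, h0, h1, h2, hab, rfl⟩))

lemma aux_diag {p : ℕ} [Fact p.Prime] {a : ZMod p} (h : a ≠ 0) :
    (symQT {a, a} : BQ (ZMod p) 2) = symQT {0, a} := by
  have h0 := aux_adm (b := a) (Or.inl h)
  have h1 := aux_adm (a := 0) (Or.inr h)
  rw [symQT, symQT, dif_pos h0, dif_pos h1]
  rw [← sub_eq_zero]
  exact (Submodule.Quotient.mk_eq_zero _).2
    (Submodule.subset_span (Or.inr ⟨a, 0, h0, h1, rfl⟩))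

lemma ang_symm {p : ℕ} (a b : ZMod p) : ang a b = ang b a := by
  rw [ang, ang, Multiset.pair_comm]
  simp only [or_comm]

lemma ang_neg_self {p : ℕ} [Fact p.Prime] {a : ZMod p} (h : a ≠ 0) : ang a (-a) = 0 := by
  have := aux_blow (a := a) (b := 0) (Or.inl h) h
  simp only [zero_sub, sub_zero, right_eq_add] at this
  rw [ang, this, smul_zero]

lemma ang_rel {p : ℕ} [Fact p.Prime] {a b : ZMod p} (h : a ≠ 0 ∨ b ≠ 0) :
    ang a b = ang a (b - a) + ang (a - b) b := by
  by_cases ha : a = 0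
  · subst ha
    have hb : b ≠ 0 := by simpa using h
    rw [sub_zero, zero_sub, ang_symm (-b) b, ang_neg_self hb, add_zero]
  by_cases hb : b = 0
  · subst hb
    rw [sub_zero, zero_sub, ang_neg_self ha, zero_add]
  by_cases hab : a = b
  · subst hab
    rw [sub_self, ang_symm a 0, ← two_smul ℚ (ang 0 a)]
    simp only [ang, ha, or_self, if_false, true_or, if_true, one_smul, smul_smul]
    rw [aux_diag ha]
    norm_num
  · have h1 : b - a ≠ 0 := sub_ne_zero.2 (Ne.symm hab)
    have h2 : a - b ≠ 0 := sub_ne_zero.2 hab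
    simp only [ang, ha, hb, h1, h2, or_self, if_false, one_smul]
    exact aux_blow h hab

lemma delta_symm {p : ℕ} (a b : ZMod p) : delta a b = delta b a := by
  simp only [delta]
  rw [ang_symm a b, ang_symm (-a) b, ang_symm a (-b), ang_symm (-a) (-b)]
  abel

lemma delta_sub {p : ℕ} [Fact p.Prime] {a b : ZMod p} (h : a ≠ 0 ∨ b ≠ 0) :
    delta a b = delta a (b - a) := by
  have e1 := ang_rel h
  have e2 := ang_rel (a := -a) (b := -b) (by simpa using h)
  have h3 : a ≠ 0 ∨ a - b ≠ 0 := by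
    by_contra! hc
    obtain ⟨rfl, hc⟩ := hc
    simp at hc
    simp [hc] at h
  have e3 := ang_rel h3
  have e4 := ang_rel (a := -a) (b := -(a - b)) (h3.imp neg_ne_zero.2 neg_ne_zero.2)
  have r1 : -b - -a = a - b := by ring
  have r2 : -a - -b = b - a := by ring
  have r3 : a - b - a = -b := by ring
  have r4 : a - (a - b) = b := by ring
  have r5 : -(a - b) - -a = b := by ring
  have r6 : -a - -(a - b) = -b := by ring
  have r7 : -(a - b) = b - a := by ring
  have r8 : -(b - a) = a - b := by ring
  rw [r1, r2] at e2
  rw [r3, r4, ang_symm b] at e3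
  rw [r5, r6, r7, ang_symm (-b)] at e4
  simp only [delta]
  rw [r8, e1, e2, e3, e4]
  abel

lemma delta_any {p : ℕ} [Fact p.Prime] {a : ZMod p} (ha : a ≠ 0) (b c : ZMod p) :
    delta a b = delta a c := by
  have key : ∀ (n : ℕ) (b : ZMod p), delta a b = delta a (b - n * a) := by
    intro n
    induction n with
    | zero => intro b; simp
    | succ n ih =>
      intro b
      rw [ih b, delta_sub (Or.inl ha)]
      congr 1
      push_cast
      ring
  rw [key ((b - c) / a).val b]
  congr 1
  rw [ZMod.natCast_val, ZMod.cast_id, div_mul_cancel₀ _ ha]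
  ring

lemma delta_const {p : ℕ} [Fact p.Prime] {a b : ZMod p} (h : a ≠ 0 ∨ b ≠ 0) :
    delta a b = delta 1 0 := by
  have key : ∀ a b : ZMod p, a ≠ 0 → delta a b = delta 1 0 := by
    intro a b ha
    rw [delta_any ha b 1, delta_symm, delta_any one_ne_zero a 0]
  rcases h with h | h
  · exact key a b h
  · rw [delta_symm]
    exact key b a h

/-- for a prime `p ≥ 5` and a pair `(a,b)` generating `ℤ/p`, the
element `δ(a,b) ∈ 𝓑₂(C_p) ⊗ ℚ` is invariant under the `SL₂(ℤ/p)`-action on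
`(a,b)`; in particular `δ(a,b) = δ(-b,a)` and `δ(a,b) = δ(a,b-a)`. -/
theorem delta_SL2_invariant (p : ℕ) (hp : p.Prime) (hp5 : 5 ≤ p)
    (a b : ZMod p) (hab : Adm ({a, b} : Multiset (ZMod p))) :
    (∀ g : Matrix.SpecialLinearGroup (Fin 2) (ZMod p),
      delta a b = delta (g.1 0 0 * a + g.1 0 1 * b) (g.1 1 0 * a + g.1 1 1 * b)) ∧
    delta a b = delta (-b) a ∧ delta a b = delta a (b - a) := by 
  haveI : Fact p.Prime := ⟨hp⟩
  have h : a ≠ 0 ∨ b ≠ 0 := by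
    by_contra! hc
    obtain ⟨rfl, rfl⟩ := hc
    have h1 : (1 : ZMod p) ∈ AddSubgroup.closure {x | x ∈ ({0, 0} : Multiset (ZMod p))} := by
      rw [hab]
      trivial
    have h2 : AddSubgroup.closure {x | x ∈ ({0, 0} : Multiset (ZMod p))} ≤ ⊥ := by
      rw [AddSubgroup.closure_le]
      intro x hx
      simpa using hx
    have h3 := h2 h1
    rw [AddSubgroup.mem_bot] at h3
    exact one_ne_zero h3
  refine ⟨fun g => ?_, ?_, delta_sub h⟩
  · refine (delta_const h).trans (Eq.symm (delta_const ?_))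
    by_contra! hc
    obtain ⟨h1, h2⟩ := hc
    have hd := g.2
    rw [Matrix.det_fin_two] at hd
    have ha : a = 0 := by linear_combination g.1 1 1 * h1 - g.1 0 1 * h2 - a * hd
    have hb : b = 0 := by linear_combination g.1 0 0 * h2 - g.1 1 0 * h1 - b * hd
    simp [ha, hb] at h
  · refine (delta_const h).trans (Eq.symm (delta_const ?_))
    simpa using h.symm
end

section
/- In the subgroup R of Burn_2(C_2 × C_2) generated by points and rational curves, the relations force q_i = f_i = 0 for i = 1,2,3, and the quotient of R by the subgroup generated by e_1, e_2, e_3 is isomorphic to B_2(C_2 × C_2) ≅ Z/2 × Z/2; in particular there is a short exact sequence 0 → ⟨e_1,e_2,e_3⟩ ≅ Z³ → R → B_2(C_2×C_2) → 0. -/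
open FreeAbelianGroup

abbrev Klein := ZMod 2 × ZMod 2

lemma adm_klein {a b : Klein}
    (h : ∀ x : Klein, x = 0 ∨ x = a ∨ x = b ∨ x = a + b) :
    Adm ({a, b} : Multiset Klein) := by
  rw [Adm, AddSubgroup.eq_top_iff']
  intro x
  have ha : a ∈ AddSubgroup.closure {y | y ∈ ({a, b} : Multiset Klein)} :=
    AddSubgroup.subset_closure (by simp)
  have hb : b ∈ AddSubgroup.closure {y | y ∈ ({a, b} : Multiset Klein)} :=
    AddSubgroup.subset_closure (by simp)
  rcases h x with h | h | h | h <;> subst h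
  · exact zero_mem _
  · exact ha
  · exact hb
  · exact add_mem ha hb

def χ₁ : Klein := (1, 0)
def χ₂ : Klein := (0, 1)

def k12 : B Klein 2 := symb {χ₁, χ₂} ⟨by decide, adm_klein (by decide)⟩
def k13 : B Klein 2 := symb {χ₁, χ₁ + χ₂} ⟨by decide, adm_klein (by decide)⟩
def k23 : B Klein 2 := symb {χ₁ + χ₂, χ₂} ⟨by decide, adm_klein (by decide)⟩

/-- Generators of the points-and-rational-curves subgroup `R ⊂ Burn₂(C₂ × C₂)`:
the point classes `[χ_i,χ_j]`, and the classes `e_i`, `q_i`, `f_i`. -/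
inductive GenR
  | x12 | x13 | x23 | e (i : Fin 3) | q (i : Fin 3) | f (i : Fin 3)
  deriving DecidableEq

open GenR

/-- The relations of `R`: `[χ_i,χ_j] = e_h + [χ_h,χ_i] + [χ_h,χ_j]` for
`{h,i,j} = {1,2,3}`, `q_i = f_i` (blow up the orbit `q_i`), and
`e_i = e_i + f_i` (blow up a general orbit of `e_i`). -/
def relsR : Set (FreeAbelianGroup GenR) :=
  { of x23 - of (e 0) - of x12 - of x13,
    of x13 - of (e 1) - of x12 - of x23,
    of x12 - of (e 2) - of x13 - of x23 } ∪
  (Set.range fun i => of (q i) - of (f i)) ∪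
  (Set.range fun i => of (f i))

/-- The points-and-rational-curves subgroup `R` of `Burn₂(C₂ × C₂)`. -/
def R : Type := FreeAbelianGroup GenR ⧸ AddSubgroup.closure relsR

instance : AddCommGroup R := by unfold R; infer_instance

def clsR (g : GenR) : R := QuotientAddGroup.mk (of g)

/-- The subgroup of `R` generated by `e₁, e₂, e₃`. -/
def E : AddSubgroup R := AddSubgroup.closure {clsR (e 0), clsR (e 1), clsR (e 2)}

/-- The quotient map onto `R`. -/
def mkR : FreeAbelianGroup GenR →+ R :=
  QuotientAddGroup.mk' (AddSubgroup.closure relsR)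

/-- The quotient map onto `B`. -/
def mkB : FreeAbelianGroup (Symb Klein 2) →+ B Klein 2 :=
  QuotientAddGroup.mk' (AddSubgroup.closure (blowupRels Klein 2))

lemma mkR_of (g : GenR) : mkR (of g) = clsR g := rfl

lemma mkB_of (s : Symb Klein 2) : mkB (of s) = symb s.1 s.2 := rfl

lemma mkR_rel {x : FreeAbelianGroup GenR} (h : x ∈ relsR) : mkR x = 0 :=
  (QuotientAddGroup.eq_zero_iff (N := AddSubgroup.closure relsR) x).2
    (AddSubgroup.subset_closure h)

lemma mkB_rel {x : FreeAbelianGroup (Symb Klein 2)} (h : x ∈ blowupRels Klein 2) : mkB x = 0 :=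
  (QuotientAddGroup.eq_zero_iff (N := AddSubgroup.closure (blowupRels Klein 2)) x).2
    (AddSubgroup.subset_closure h)

/-- Universal property of `R`. -/
lemma exists_liftR {M : Type} [AddCommGroup M] (F : GenR → M)
    (h : ∀ x ∈ relsR, FreeAbelianGroup.lift F x = 0) :
    ∃ Φ : R →+ M, ∀ g, Φ (clsR g) = F g :=
  ⟨QuotientAddGroup.lift (AddSubgroup.closure relsR) (FreeAbelianGroup.lift F)
    ((AddSubgroup.closure_le _).2 h), fun g => FreeAbelianGroup.lift_apply_of F g⟩

/-- Universal property of `B Klein 2`. -/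
lemma exists_liftB {M : Type} [AddCommGroup M] (F : Symb Klein 2 → M)
    (h : ∀ x ∈ blowupRels Klein 2, FreeAbelianGroup.lift F x = 0) :
    ∃ Φ : B Klein 2 →+ M, ∀ s : Symb Klein 2, Φ (symb s.1 s.2) = F s :=
  ⟨QuotientAddGroup.lift (AddSubgroup.closure (blowupRels Klein 2)) (FreeAbelianGroup.lift F)
    ((AddSubgroup.closure_le _).2 h), fun g => FreeAbelianGroup.lift_apply_of F g⟩

lemma homR_ext {M : Type} [AddCommGroup M] {f g : R →+ M}
    (h : ∀ x, f (clsR x) = g (clsR x)) : f = g := by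
  have : f.comp mkR = g.comp mkR := FreeAbelianGroup.lift_ext _ _ fun x => h x
  ext x
  obtain ⟨y, rfl⟩ := QuotientAddGroup.mk'_surjective (AddSubgroup.closure relsR) x
  exact DFunLike.congr_fun this y

lemma homB_ext {M : Type} [AddCommGroup M] {f g : B Klein 2 →+ M}
    (h : ∀ s : Symb Klein 2, f (symb s.1 s.2) = g (symb s.1 s.2)) : f = g := by
  have : f.comp mkB = g.comp mkB := FreeAbelianGroup.lift_ext _ _ fun x => h x
  ext x
  obtain ⟨y, rfl⟩ := QuotientAddGroup.mk'_surjective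
    (AddSubgroup.closure (blowupRels Klein 2)) x
  exact DFunLike.congr_fun this y

lemma f_zero (i : Fin 3) : clsR (f i) = 0 := by
  have := mkR_rel (x := of (f i)) (Or.inr ⟨i, rfl⟩)
  simpa [mkR_of] using this

lemma q_zero (i : Fin 3) : clsR (q i) = 0 := by
  have := mkR_rel (x := of (q i) - of (f i)) (Or.inl (Or.inr ⟨i, rfl⟩))
  simpa [mkR_of, f_zero] using this

lemma rel0 : clsR x23 - clsR (e 0) - clsR x12 - clsR x13 = 0 := by
  have := mkR_rel (x := of x23 - of (e 0) - of x12 - of x13) (Or.inl (Or.inl (by simp)))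
  simpa only [map_sub, mkR_of] using this

lemma rel1 : clsR x13 - clsR (e 1) - clsR x12 - clsR x23 = 0 := by
  have := mkR_rel (x := of x13 - of (e 1) - of x12 - of x23) (Or.inl (Or.inl (by simp)))
  simpa only [map_sub, mkR_of] using this

lemma rel2 : clsR x12 - clsR (e 2) - clsR x13 - clsR x23 = 0 := by
  have := mkR_rel (x := of x12 - of (e 2) - of x13 - of x23) (Or.inl (Or.inl (by simp)))
  simpa only [map_sub, mkR_of] using this

/-- To respect the relations of `R` it suffices to check the five families. -/
lemma lift_rels {M : Type} [AddCommGroup M] (F : GenR → M)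
    (h0 : F x23 - F (e 0) - F x12 - F x13 = 0)
    (h1 : F x13 - F (e 1) - F x12 - F x23 = 0)
    (h2 : F x12 - F (e 2) - F x13 - F x23 = 0)
    (hq : ∀ i, F (q i) = 0) (hf : ∀ i, F (f i) = 0) :
    ∀ x ∈ relsR, FreeAbelianGroup.lift F x = 0 := by
  rintro x ((h | ⟨i, rfl⟩) | ⟨i, rfl⟩)
  · rcases h with rfl | rfl | rfl <;> simpa only [map_sub, FreeAbelianGroup.lift_apply_of]
  · simp [hq, hf]
  · simp [hf]

lemma klein_add : ∀ a b x y : Klein, (x = 0 ∨ x = a ∨ x = b ∨ x = a + b) →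
    (y = 0 ∨ y = a ∨ y = b ∨ y = a + b) →
    (x + y = 0 ∨ x + y = a ∨ x + y = b ∨ x + y = a + b) := by decide

lemma klein_neg : ∀ a b x : Klein, (x = 0 ∨ x = a ∨ x = b ∨ x = a + b) →
    (-x = 0 ∨ -x = a ∨ -x = b ∨ -x = a + b) := by decide

lemma hom_sub3 {S M : Type} [AddCommGroup M] (g : FreeAbelianGroup S →+ M) (a b c : S) :
    g (of a - of b - of c) = g (of a) - g (of b) - g (of c) := by
  rw [map_sub, map_sub]

lemma lift_sub3 {S M : Type} [AddCommGroup M] (F : S → M) (a b c : S) :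
    FreeAbelianGroup.lift F (of a - of b - of c) = F a - F b - F c := by
  simp

lemma adm_klein_conv {a b : Klein} (h : Adm (a ::ₘ b ::ₘ 0)) (x : Klein) :
    x = 0 ∨ x = a ∨ x = b ∨ x = a + b := by
  have hx : x ∈ AddSubgroup.closure {y | y ∈ a ::ₘ b ::ₘ (0 : Multiset Klein)} := by
    rw [Adm] at h; rw [h]; trivial
  induction hx using AddSubgroup.closure_induction with
  | mem x hx => simp at hx; tauto
  | zero => simp
  | add x y _ _ hx hy => exact klein_add a b x y hx hy
  | neg x _ hx => exact klein_neg a b x hx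

lemma classify : ∀ a b : Klein, (∀ x : Klein, x = 0 ∨ x = a ∨ x = b ∨ x = a + b) →
    (a ::ₘ b ::ₘ 0 = ({χ₁, χ₂} : Multiset Klein)) ∨
    (a ::ₘ b ::ₘ 0 = ({χ₁, χ₁ + χ₂} : Multiset Klein)) ∨
    (a ::ₘ b ::ₘ 0 = ({χ₁ + χ₂, χ₂} : Multiset Klein)) := by decide

lemma symb_cases (s : Symb Klein 2) : s.1 = ({χ₁, χ₂} : Multiset Klein) ∨
    s.1 = ({χ₁, χ₁ + χ₂} : Multiset Klein) ∨ s.1 = ({χ₁ + χ₂, χ₂} : Multiset Klein) := by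
  obtain ⟨s, hc, ha⟩ := s
  obtain ⟨a, b, rfl⟩ := Multiset.card_eq_two.1 hc
  exact classify a b (adm_klein_conv ha)

/-- Index of a symbol. -/
def idx (s : Multiset Klein) : Fin 3 :=
  if s = {χ₁, χ₂} then 0 else if s = {χ₁, χ₁ + χ₂} then 1 else 2

lemma idx_rel : ∀ a b : Klein, (∀ x : Klein, x = 0 ∨ x = a ∨ x = b ∨ x = a + b) →
    (idx (a ::ₘ b ::ₘ 0), idx (a ::ₘ (b - a) ::ₘ 0), idx ((a - b) ::ₘ b ::ₘ 0)) ∈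
      ({(0, 1, 2), (0, 2, 1), (1, 0, 2), (1, 2, 0), (2, 0, 1), (2, 1, 0)} :
        Finset (Fin 3 × Fin 3 × Fin 3)) := by decide

lemma not_diag : ∀ a : Klein, ¬ (∀ x : Klein, x = 0 ∨ x = a ∨ x = a ∨ x = a + a) := by decide

lemma card_tail {a b : Klein} {t : Multiset Klein} (h : Multiset.card (a ::ₘ b ::ₘ t) = 2) :
    t = 0 := by
  simpa using h

lemma liftB_rels {M : Type} [AddCommGroup M] (v : Fin 3 → M)
    (h0 : v 0 = v 1 + v 2) (h1 : v 1 = v 0 + v 2) (h2 : v 2 = v 0 + v 1) :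
    ∀ x ∈ blowupRels Klein 2,
      FreeAbelianGroup.lift (fun s : Symb Klein 2 => v (idx s.1)) x = 0 := by
  rintro x (⟨a, b, t, h, h', h'', -, rfl⟩ | ⟨a, t, h, h', rfl⟩)
  · obtain rfl := card_tail h.1
    refine (lift_sub3 _ _ _ _).trans ?_
    change v (idx (a ::ₘ b ::ₘ 0)) - v (idx (a ::ₘ (b - a) ::ₘ 0))
      - v (idx ((a - b) ::ₘ b ::ₘ 0)) = 0
    have := idx_rel a b (adm_klein_conv h.2)
    generalize idx (a ::ₘ b ::ₘ 0) = i at *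
    generalize idx (a ::ₘ (b - a) ::ₘ 0) = j at *
    generalize idx ((a - b) ::ₘ b ::ₘ 0) = k at *
    simp only [Finset.mem_insert, Finset.mem_singleton, Prod.mk.injEq] at this
    rw [sub_sub, sub_eq_zero]
    rcases this with ⟨rfl, rfl, rfl⟩ | ⟨rfl, rfl, rfl⟩ | ⟨rfl, rfl, rfl⟩ | ⟨rfl, rfl, rfl⟩ |
      ⟨rfl, rfl, rfl⟩ | ⟨rfl, rfl, rfl⟩ <;> first | assumption | (rw [add_comm]; assumption)
  · obtain rfl := card_tail h.1
    exact absurd (adm_klein_conv h.2) (not_diag a)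

lemma symb_congr {s t : Multiset Klein} (h : s = t) (hs : Multiset.card s = 2 ∧ Adm s)
    (ht : Multiset.card t = 2 ∧ Adm t) : symb s hs = symb t ht := by
  subst h; rfl

/-- A blow-up relation in `B`. -/
lemma B_rel {a b c : Klein} (hab : a ≠ b) (h1 : b - a = c) (h2 : a - b = c)
    (h : Multiset.card (a ::ₘ b ::ₘ 0) = 2 ∧ Adm (a ::ₘ b ::ₘ 0))
    (h' : Multiset.card (a ::ₘ c ::ₘ 0) = 2 ∧ Adm (a ::ₘ c ::ₘ 0))
    (h'' : Multiset.card (c ::ₘ b ::ₘ 0) = 2 ∧ Adm (c ::ₘ b ::ₘ 0)) :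
    symb (a ::ₘ b ::ₘ 0) h = symb (a ::ₘ c ::ₘ 0) h' + symb (c ::ₘ b ::ₘ 0) h'' := by
  have := mkB_rel (x := of (⟨_, h⟩ : Symb Klein 2) - of ⟨_, h'⟩ - of ⟨_, h''⟩)
    (Or.inl ⟨a, b, 0, h, by rw [h1]; exact h', by rw [h2]; exact h'', hab, by
      congr 3
      · simp [h1]
      · simp [h2]⟩)
  have := (hom_sub3 mkB _ _ _).symm.trans this
  rw [sub_sub, sub_eq_zero] at this
  exact this

lemma kadm (a b : Klein) (h : ∀ x : Klein, x = 0 ∨ x = a ∨ x = b ∨ x = a + b) :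
    Multiset.card (a ::ₘ b ::ₘ 0) = 2 ∧ Adm (a ::ₘ b ::ₘ 0) := ⟨rfl, adm_klein h⟩

lemma k12_eq : k12 = k13 + k23 :=
  B_rel (a := χ₁) (b := χ₂) (c := χ₁ + χ₂) (by decide) (by decide) (by decide) _ _ _

lemma k13_eq : k13 = k12 + k23 := by
  have := B_rel (a := χ₁) (b := χ₁ + χ₂) (c := χ₂) (by decide) (by decide) (by decide)
    (kadm _ _ (by decide)) (kadm _ _ (by decide)) (kadm _ _ (by decide))
  rw [symb_congr (s := χ₂ ::ₘ (χ₁ + χ₂) ::ₘ 0) (t := {χ₁ + χ₂, χ₂}) (by decide) _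
    (kadm _ _ (by decide))] at this
  exact this

lemma k23_eq : k23 = k12 + k13 := by
  have := B_rel (a := χ₁ + χ₂) (b := χ₂) (c := χ₁) (by decide) (by decide) (by decide)
    (kadm _ _ (by decide)) (kadm _ _ (by decide)) (kadm _ _ (by decide))
  rw [symb_congr (s := (χ₁ + χ₂) ::ₘ χ₁ ::ₘ 0) (t := {χ₁, χ₁ + χ₂}) (by decide) _
    (kadm _ _ (by decide))] at this
  exact this.trans (add_comm _ _)

/-- Images of the generators of `R` in `B`. -/
def FB : GenR → B Klein 2
  | x12 => k12
  | x13 => k13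
  | x23 => k23
  | _ => 0

/-- Images of the generators of `R` in `ℤ³`. -/
def FZ : GenR → ℤ × ℤ × ℤ
  | x12 => (1, 0, 0)
  | x13 => (0, 1, 0)
  | x23 => (0, 0, 1)
  | e i => ![(-1, -1, 1), (-1, 1, -1), (1, -1, -1)] i
  | _ => 0

lemma E_equiv : ∃ _ψ : E ≃+ ℤ × ℤ × ℤ, True := by
  obtain ⟨Φ, hΦ⟩ := exists_liftR FZ (lift_rels FZ (by decide) (by decide) (by decide)
    (fun _ => rfl) (fun _ => rfl))
  let J : ℤ × ℤ × ℤ →+ R :=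
    { toFun := fun p => p.1 • clsR (e 0) + p.2.1 • clsR (e 1) + p.2.2 • clsR (e 2)
      map_zero' := by simp
      map_add' := fun p p' => by simp only [Prod.fst_add, Prod.snd_add, add_smul]; abel }
  have hJ : ∀ p, J p = p.1 • clsR (e 0) + p.2.1 • clsR (e 1) + p.2.2 • clsR (e 2) :=
    fun _ => rfl
  have hinj : Function.Injective J := by
    rw [injective_iff_map_eq_zero]
    rintro ⟨a, b, c⟩ h
    have h := congrArg Φ h
    rw [hJ] at h
    simp [hΦ, FZ, Prod.ext_iff] at h
    obtain ⟨h1, h2, h3⟩ := h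
    ext <;> simp <;> omega
  have hr : J.range = E := by
    apply le_antisymm
    · rintro _ ⟨p, rfl⟩
      rw [hJ]
      have m : ∀ i : Fin 3, clsR (e i) ∈ E := fun i =>
        AddSubgroup.subset_closure (by fin_cases i <;> simp)
      exact add_mem (add_mem (zsmul_mem (m 0) _) (zsmul_mem (m 1) _)) (zsmul_mem (m 2) _)
    · refine (AddSubgroup.closure_le _).2 ?_
      rintro x (rfl | rfl | rfl)
      · exact ⟨(1, 0, 0), by simp [hJ]⟩
      · exact ⟨(0, 1, 0), by simp [hJ]⟩
      · exact ⟨(0, 0, 1), by simp [hJ]⟩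
  exact ⟨((AddMonoidHom.ofInjective hinj).trans (AddEquiv.addSubgroupCongr hr)).symm, trivial⟩

lemma quot_equiv : ∃ φ : R ⧸ E ≃+ B Klein 2,
      φ (QuotientAddGroup.mk (clsR x12)) = k12 ∧
      φ (QuotientAddGroup.mk (clsR x13)) = k13 ∧
      φ (QuotientAddGroup.mk (clsR x23)) = k23 := by
  obtain ⟨Φ, hΦ⟩ := exists_liftR FB (lift_rels FB
    (by simp only [FB]; rw [sub_zero, sub_sub, sub_eq_zero]; exact k23_eq)
    (by simp only [FB]; rw [sub_zero, sub_sub, sub_eq_zero]; exact k13_eq)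
    (by simp only [FB]; rw [sub_zero, sub_sub, sub_eq_zero]; exact k12_eq)
    (fun _ => rfl) (fun _ => rfl))
  have hE : E ≤ Φ.ker := by
    refine (AddSubgroup.closure_le _).2 ?_
    rintro x (rfl | rfl | rfl) <;> exact hΦ _
  let P : R →+ R ⧸ E := QuotientAddGroup.mk' E
  have hP : ∀ i : Fin 3, P (clsR (e i)) = 0 := fun i =>
    (QuotientAddGroup.eq_zero_iff _).2
      (AddSubgroup.subset_closure (by fin_cases i <;> simp))
  let v : Fin 3 → R ⧸ E := ![P (clsR x12), P (clsR x13), P (clsR x23)]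
  have r0 := congrArg P rel0
  have r1 := congrArg P rel1
  have r2 := congrArg P rel2
  rw [map_sub, map_sub, map_sub, hP, sub_zero, map_zero, sub_sub, sub_eq_zero] at r0 r1 r2
  obtain ⟨Ψ, hΨ⟩ := exists_liftB (fun s : Symb Klein 2 => v (idx s.1)) (liftB_rels v r2 r1 r0)
  have p12 : Ψ k12 = P (clsR x12) := 
    (hΨ ⟨{χ₁, χ₂}, kadm _ _ (by decide)⟩).trans
      (congrArg v (show idx _ = 0 by decide))
  have p13 : Ψ k13 = P (clsR x13) := 
    (hΨ ⟨{χ₁, χ₁ + χ₂}, kadm _ _ (by decide)⟩).trans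
      (congrArg v (show idx _ = 1 by decide))
  have p23 : Ψ k23 = P (clsR x23) := 
    (hΨ ⟨{χ₁ + χ₂, χ₂}, kadm _ _ (by decide)⟩).trans
      (congrArg v (show idx _ = 2 by decide))
  let Φ' : R ⧸ E →+ B Klein 2 := QuotientAddGroup.lift E Φ hE
  have hΦ' : ∀ x, Φ' (P x) = Φ x := fun x => rfl
  have c1 : Ψ.comp Φ' = AddMonoidHom.id _ := by
    apply QuotientAddGroup.addMonoidHom_ext
    apply homR_ext
    intro x
    change Ψ (Φ' (P (clsR x))) = P (clsR x)
    rw [hΦ', hΦ]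
    cases x with
    | x12 => exact p12
    | x13 => exact p13
    | x23 => exact p23
    | e i => simp only [FB]; rw [hP, map_zero]
    | q i => simp only [FB]; rw [q_zero, map_zero, map_zero]
    | f i => simp only [FB]; rw [f_zero, map_zero, map_zero]
  have c2 : Φ'.comp Ψ = AddMonoidHom.id _ := by
    apply homB_ext
    intro s
    change Φ' (Ψ (symb s.1 s.2)) = symb s.1 s.2
    rcases symb_cases s with h | h | h
    · rw [symb_congr h s.2 (kadm _ _ (by decide))]
      change Φ' (Ψ k12) = k12
      rw [p12, hΦ', hΦ]; rfl
    · rw [symb_congr h s.2 (kadm _ _ (by decide))]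
      change Φ' (Ψ k13) = k13
      rw [p13, hΦ', hΦ]; rfl
    · rw [symb_congr h s.2 (kadm _ _ (by decide))]
      change Φ' (Ψ k23) = k23
      rw [p23, hΦ', hΦ]; rfl
  exact ⟨AddMonoidHom.toAddEquiv Φ' Ψ c1 c2, hΦ x12, hΦ x13, hΦ x23⟩

/-- in `R` the relations force `q_i = f_i = 0`; the subgroup
generated by `e₁,e₂,e₃` is free of rank 3, and `R/⟨e₁,e₂,e₃⟩ ≅ 𝓑₂(C₂ × C₂)`
(the Klein four group), giving the short exact sequence
`0 → ℤ³ → R → 𝓑₂(C₂×C₂) → 0`. -/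
theorem Burn2_Klein_R :
    (∀ i : Fin 3, clsR (q i) = 0 ∧ clsR (f i) = 0) ∧
    (∃ ψ : E ≃+ ℤ × ℤ × ℤ, True) ∧
    (∃ φ : R ⧸ E ≃+ B Klein 2,
      φ (QuotientAddGroup.mk (clsR x12)) = k12 ∧
      φ (QuotientAddGroup.mk (clsR x13)) = k13 ∧
      φ (QuotientAddGroup.mk (clsR x23)) = k23) :=
  ⟨fun i => ⟨q_zero i, f_zero i⟩, E_equiv, quot_equiv⟩
end
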